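/- arXiv:math/0510570 — 2 statements merged into one kernel-verified Lean document; each statement's English description precedes it below -/
import Mathlib

section
/- Let β ∈ [1/2, 1], y > 0, σ > 1, and set τ = (1 + √(1 + 4σ²))/2. Then Re[ 1/(σ − β + iy) + 1/(σ − 1 + β + iy) − (1/√5)·( 1/(τ − β + iy) + 1/(τ − 1 + β + iy) ) ] ≥ 0. -/
set_option autoImplicit false

open scoped Real

open Complex

/-- The real part of the reciprocal of a complex number given by its coordinates. -/
theorem re_one_div_add_I_mul (x y : ℝ) :
    (1 / ((x : ℂ) + I * y)).re = x / (x ^ 2 + y ^ 2) := by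
  rw [one_div, Complex.inv_re]
  simp [Complex.normSq_apply, sq]

/-- The symmetric sum of the real parts of `1 / (x - b + iy)` and `1 / (x + b + iy)`,
written as a single quotient. -/
theorem sum_div_sq_add_sq (x b y : ℝ) (hy : 0 < y) (hb : b ^ 2 ≤ x ^ 2) :
    (x - b) / ((x - b) ^ 2 + y ^ 2) + (x + b) / ((x + b) ^ 2 + y ^ 2)
      = 2 * (x / (x ^ 2 - b ^ 2 + y ^ 2 + 4 * b ^ 2 * y ^ 2 / (x ^ 2 - b ^ 2 + y ^ 2))) := by
  have hN : 0 < x ^ 2 - b ^ 2 + y ^ 2 := by nlinarith [pow_pos hy 2]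
  have h₁ : 0 < (x - b) ^ 2 + y ^ 2 := by positivity
  have h₂ : 0 < (x + b) ^ 2 + y ^ 2 := by positivity
  have h₃ : x ^ 2 - b ^ 2 + y ^ 2 + 4 * b ^ 2 * y ^ 2 / (x ^ 2 - b ^ 2 + y ^ 2)
      = ((x - b) ^ 2 + y ^ 2) * ((x + b) ^ 2 + y ^ 2) / (x ^ 2 - b ^ 2 + y ^ 2) := by
    rw [eq_div_iff hN.ne', add_mul, div_mul_cancel₀ _ hN.ne']
    ring
  rw [h₃, div_add_div _ _ h₁.ne' h₂.ne', div_div_eq_mul_div, ← mul_div_assoc]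
  congr 1
  ring

/-- The function `u ↦ u + c / u` does not decrease from `m` to `n` when `c ≤ m * n`. -/
theorem add_div_le_add_div_of_le_mul {m n c : ℝ} (hm : 0 < m) (hmn : m ≤ n) (hc : c ≤ m * n) :
    m + c / m ≤ n + c / n := by
  have hn : 0 < n := hm.trans_le hmn
  have h : n + c / n - (m + c / m) = (n - m) * (m * n - c) / (m * n) := by
    field_simp
    ring
  have : 0 ≤ (n - m) * (m * n - c) / (m * n) :=
    div_nonneg (mul_nonneg (sub_nonneg.2 hmn) (sub_nonneg.2 hc)) (mul_pos hm hn).le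
  linarith

/-- **Stechkin's lemma (1970).** For `β ∈ [1/2, 1]`, `y > 0`, `σ > 1` and
`τ = (1 + √(1 + 4σ²))/2`, the real part of the combination
`1/(σ-β+iy) + 1/(σ-1+β+iy) - (1/√5)(1/(τ-β+iy) + 1/(τ-1+β+iy))` is non-negative. -/
theorem stechkin_lemma (β y σ τ : ℝ)
    (hβ : β ∈ Set.Icc (1 / 2 : ℝ) 1) (hy : 0 < y) (hσ : 1 < σ)
    (hτ : τ = (1 + Real.sqrt (1 + 4 * σ ^ 2)) / 2) :
    0 ≤ (1 / ((σ : ℂ) - β + I * y) + 1 / ((σ : ℂ) - 1 + β + I * y)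
          - (1 / Real.sqrt 5 : ℝ) * (1 / ((τ : ℂ) - β + I * y)
              + 1 / ((τ : ℂ) - 1 + β + I * y))).re := by
  obtain ⟨hβ₁, hβ₂⟩ := hβ
  obtain ⟨a, rfl⟩ : ∃ a, σ = a + 1 / 2 := ⟨σ - 1 / 2, by ring⟩
  obtain ⟨b, rfl⟩ : ∃ b, β = b + 1 / 2 := ⟨β - 1 / 2, by ring⟩
  obtain ⟨t, rfl⟩ : ∃ t, τ = t + 1 / 2 := ⟨τ - 1 / 2, by ring⟩
  have ht : t = √(1 + 4 * (a + 1 / 2) ^ 2) / 2 := by linarith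
  have ht₀ : 0 ≤ t := ht ▸ by positivity
  have ht₂ : t ^ 2 = a ^ 2 + a + 1 / 2 := by
    rw [ht, div_pow, Real.sq_sqrt (by positivity)]
    ring
  have ha : 1 / 2 < a := by linarith
  have hb : b ^ 2 ≤ 1 / 4 := by nlinarith
  have hy₂ : 0 < y ^ 2 := by positivity
  have hre (x : ℝ) (hx : b ^ 2 ≤ x ^ 2) :
      (1 / (((x + 1 / 2 : ℝ) : ℂ) - ((b + 1 / 2 : ℝ) : ℂ) + I * y)
        + 1 / (((x + 1 / 2 : ℝ) : ℂ) - 1 + ((b + 1 / 2 : ℝ) : ℂ) + I * y)).re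
        = 2 * (x / (x ^ 2 - b ^ 2 + y ^ 2 + 4 * b ^ 2 * y ^ 2 / (x ^ 2 - b ^ 2 + y ^ 2))) := by
    rw [← sum_div_sq_add_sq x b y hy hx, ← re_one_div_add_I_mul, ← re_one_div_add_I_mul,
      Complex.add_re]
    congr 4 <;> push_cast <;> ring
  rw [Complex.sub_re, Complex.re_ofReal_mul, hre a (by nlinarith), hre t (by nlinarith),
    sub_nonneg, mul_left_comm]
  refine mul_le_mul_of_nonneg_left ?_ zero_le_two
  rw [← mul_div_assoc, one_div_mul_eq_div]
  have hm : 0 < a ^ 2 - b ^ 2 + y ^ 2 := by nlinarith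
  refine div_le_div₀ (by linarith) ?_ (by positivity)
    (add_div_le_add_div_of_le_mul hm (by linarith) ?_)
  · rw [div_le_iff₀ (by positivity)]
    refine abs_le_of_sq_le_sq' ?_ (by positivity) |>.2
    rw [mul_pow, Real.sq_sqrt (by norm_num), ht₂]
    nlinarith
  · have h₁ : y ^ 2 ≤ a ^ 2 - b ^ 2 + y ^ 2 := by nlinarith
    have h₂ : 1 ≤ t ^ 2 - b ^ 2 + y ^ 2 := by nlinarith
    nlinarith [mul_le_mul h₁ h₂ zero_le_one hm.le]
end

section
/- For all real x > 0 and y > 0: | Re ∫₀^{∞} ( u − ⌊u⌋ − 1/2 ) / ( u + (x + iy)/2 )² du | ≤ (1/y)·arctan( y/x ). -/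
set_option autoImplicit false

open scoped Real

open Complex MeasureTheory

lemma hasDerivAt_inv_mul_arctan_affine {y : ℝ} (x u : ℝ) (hy : 0 < y) :
    HasDerivAt (fun u => (1 / y) * Real.arctan ((2 * u + x) / y))
      (2 / ((2 * u + x) ^ 2 + y ^ 2)) u := by
  have h : HasDerivAt (fun u : ℝ => (2 * u + x) / y) (2 * 1 / y) u :=
    (((hasDerivAt_id u).const_mul 2).add_const x).div_const y
  refine (h.arctan.const_mul (1 / y)).congr_deriv ?_
  have h1 : (2 * u + x) ^ 2 + y ^ 2 ≠ 0 := by positivity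
  have h2 : 1 + ((2 * u + x) / y) ^ 2 ≠ 0 := by positivity
  field_simp
  ring

lemma tendsto_inv_mul_arctan_affine {y : ℝ} (x : ℝ) (hy : 0 < y) :
    Filter.Tendsto (fun u => (1 / y) * Real.arctan ((2 * u + x) / y)) Filter.atTop
      (nhds ((1 / y) * (π / 2))) := by
  have h : Filter.Tendsto (fun u : ℝ => (2 * u + x) / y) Filter.atTop Filter.atTop :=
    (Filter.tendsto_atTop_add_const_right _ x
      (Filter.tendsto_id.const_mul_atTop two_pos)).atTop_div_const hy
  exact ((tendsto_nhds_of_tendsto_nhdsWithin Real.tendsto_arctan_atTop).comp h).const_mul (1 / y)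

lemma integrableOn_Ioi_two_div_sq_add_sq {y : ℝ} (x : ℝ) (hy : 0 < y) :
    IntegrableOn (fun u : ℝ => 2 / ((2 * u + x) ^ 2 + y ^ 2)) (Set.Ioi 0) :=
  integrableOn_Ioi_deriv_of_nonneg'
    (fun u _ => hasDerivAt_inv_mul_arctan_affine x u hy) (fun _ _ => by positivity)
    (tendsto_inv_mul_arctan_affine x hy)

lemma integral_Ioi_two_div_sq_add_sq {x y : ℝ} (hx : 0 < x) (hy : 0 < y) :
    ∫ u in Set.Ioi (0 : ℝ), 2 / ((2 * u + x) ^ 2 + y ^ 2) = (1 / y) * Real.arctan (y / x) := by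
  rw [integral_Ioi_of_hasDerivAt_of_nonneg'
    (fun u _ => hasDerivAt_inv_mul_arctan_affine x u hy) (fun _ _ => by positivity)
    (tendsto_inv_mul_arctan_affine x hy), ← inv_div x y,
    Real.arctan_inv_of_pos (div_pos hx hy), mul_zero, zero_add]
  ring

lemma abs_sub_floor_sub_half_le (u : ℝ) : |u - ⌊u⌋ - 1 / 2| ≤ 1 / 2 := by
  rw [abs_le]
  constructor <;> linarith [Int.floor_le u, Int.lt_floor_add_one u]

lemma norm_sub_floor_sub_half_div_sq_le {y : ℝ} (x u : ℝ) (hy : 0 < y) :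
    ‖((u : ℂ) - (⌊u⌋ : ℤ) - 1 / 2) / ((u : ℂ) + ((x : ℂ) + I * y) / 2) ^ 2‖ ≤
      2 / ((2 * u + x) ^ 2 + y ^ 2) := by
  have hnum : (u : ℂ) - (⌊u⌋ : ℤ) - 1 / 2 = ((u - ⌊u⌋ - 1 / 2 : ℝ) : ℂ) := by push_cast; rfl
  have hden : (u : ℂ) + ((x : ℂ) + I * y) / 2 = ((u + x / 2 : ℝ) : ℂ) + ((y / 2 : ℝ) : ℂ) * I := by
    push_cast; ring
  have hsq : ‖(u : ℂ) + ((x : ℂ) + I * y) / 2‖ ^ 2 = ((2 * u + x) ^ 2 + y ^ 2) / 4 := by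
    rw [hden, Complex.sq_norm, Complex.normSq_add_mul_I]
    ring
  have hpos : 0 < ((2 * u + x) ^ 2 + y ^ 2) / 4 := by positivity
  rw [norm_div, norm_pow, hsq, hnum, Complex.norm_real, Real.norm_eq_abs]
  calc |u - ⌊u⌋ - 1 / 2| / (((2 * u + x) ^ 2 + y ^ 2) / 4)
      ≤ 1 / 2 / (((2 * u + x) ^ 2 + y ^ 2) / 4) := by
        gcongr
        exact abs_sub_floor_sub_half_le u
    _ = 2 / ((2 * u + x) ^ 2 + y ^ 2) := by
        field_simp
        norm_num

/-- The Stirling-type error integral bound: for `x > 0` and `y > 0`,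
`|Re ∫₀^∞ (u - ⌊u⌋ - 1/2)/(u + (x+iy)/2)² du| ≤ (1/y) arctan (y/x)`. -/
theorem stirling_error_integral_bound (x y : ℝ) (hx : 0 < x) (hy : 0 < y) :
    |(∫ u in Set.Ioi (0:ℝ),
        ((u : ℂ) - (⌊u⌋ : ℤ) - 1 / 2) / ((u : ℂ) + ((x : ℂ) + I * y) / 2) ^ 2).re| ≤
      (1 / y) * Real.arctan (y / x) := by
  rw [← integral_Ioi_two_div_sq_add_sq hx hy]
  exact (Complex.abs_re_le_norm _).trans
    (norm_integral_le_of_norm_le (integrableOn_Ioi_two_div_sq_add_sq x hy)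
      (Filter.Eventually.of_forall fun u => norm_sub_floor_sub_half_div_sq_le x u hy))
end
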